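/- Let (X,d) be a compact metric space and F : X → 2^X an expansive upper semicontinuous set-valued map with nonempty compact values. If F is open, then the shift map σ_rF on Orb_r(X) has the shadowing property (as a single-valued map). -/

import Mathlib

open Metric Set

variable {X : Type*} [MetricSpace X]

/-- A set-valued map `F : X → 2^X` is *upper semicontinuous* if for every `x` and every open
`U ⊇ F x` there is an open neighborhood `V` of `x` with `F y ⊆ U` for all `y ∈ V`. -/
def SVUpperSC (F : X → Set X) : Prop :=
  ∀ x : X, ∀ U : Set X, IsOpen U → F x ⊆ U →
    ∃ V : Set X, IsOpen V ∧ x ∈ V ∧ ∀ y ∈ V, F y ⊆ U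

/-- A set-valued map is *lower semicontinuous* if for every `x` and every open `U` meeting
`F x` there is an open neighborhood `V` of `x` with `F y ∩ U ≠ ∅` for all `y ∈ V`. -/
def SVLowerSC (F : X → Set X) : Prop :=
  ∀ x : X, ∀ U : Set X, IsOpen U → (F x ∩ U).Nonempty →
    ∃ V : Set X, IsOpen V ∧ x ∈ V ∧ ∀ y ∈ V, (F y ∩ U).Nonempty

/-- A set-valued map is *continuous* if it is both upper and lower semicontinuous. -/
def SVContinuous (F : X → Set X) : Prop := SVUpperSC F ∧ SVLowerSC F

/-- `F` has nonempty compact values. -/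
def SVCompactValued (F : X → Set X) : Prop := ∀ x : X, (F x).Nonempty ∧ IsCompact (F x)

/-- Image of a set under a set-valued map: `F(U) = ⋃_{x ∈ U} F x`. -/
def SVImage (F : X → Set X) (U : Set X) : Set X := ⋃ x ∈ U, F x

/-- A set-valued map is *open* if it maps open sets to open sets. -/
def SVOpen (F : X → Set X) : Prop := ∀ U : Set X, IsOpen U → IsOpen (SVImage F U)

/-- A set-valued map is *onto* if every point lies in some value. -/
def SVOnto (F : X → Set X) : Prop := ∀ y : X, ∃ x : X, y ∈ F x

/-- The inverse set-valued map `F⁻¹(x) = {z : x ∈ F z}`. -/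
def SVInv (F : X → Set X) : X → Set X := fun x => {z | x ∈ F z}

/-- The orbit space `Orb_r(X) = {(x_n) : x_{n+1} ∈ F(x_n)}`. -/
def OrbR (F : X → Set X) : Set (ℕ → X) := {u | ∀ n : ℕ, u (n + 1) ∈ F (u n)}

/-- The left orbit space `Orb_l(X) = {(…,x_{-1},x_0) : x_i ∈ F(x_{i+1})}`, encoded by
`u n = x_{-n}`, so the defining condition reads `u (n+1) ∈ F (u n)`. -/
def OrbL (F : X → Set X) : Set (ℕ → X) := {u | ∀ n : ℕ, u (n + 1) ∈ F (u n)}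

/-- The inverse orbit space `Orb_inv(X) = {(x_n) : x_n ∈ F(x_{n+1})}`. -/
def OrbInv (F : X → Set X) : Set (ℕ → X) := {u | ∀ n : ℕ, u n ∈ F (u (n + 1))}

/-- The shift on sequences. -/
def shiftSeq (u : ℕ → X) : ℕ → X := fun n => u (n + 1)

/-- The shift map `σ_rF : Orb_r(X) → Orb_r(X)`, `(x_n) ↦ (x_{n+1})`. -/
def sigmaR (F : X → Set X) : OrbR F → OrbR F :=
  fun u => ⟨shiftSeq u.1, fun n => u.2 (n + 1)⟩

/-- The shift map `σ_lF : Orb_l(X) → Orb_l(X)`, `(x_{-n}) ↦ (x_{-n-1})`, in the encoding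
`u n = x_{-n}`. -/
def sigmaL (F : X → Set X) : OrbL F → OrbL F :=
  fun u => ⟨shiftSeq u.1, fun n => u.2 (n + 1)⟩

/-- The metric `ρ((x_n),(y_n)) = Σ_{n≥0} d(x_n,y_n)/2^{n+1}` on sequence space. -/
noncomputable def rho (u v : ℕ → X) : ℝ := ∑' n : ℕ, dist (u n) (v n) / 2 ^ (n + 1)

/-- `ρ`-distance from a point to a set of sequences. -/
noncomputable def rhoInf (u : ℕ → X) (B : Set (ℕ → X)) : ℝ := sInf (rho u '' B)

/-- Hausdorff distance with respect to `ρ` between two sets of sequences. -/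
noncomputable def rhoHaus (A B : Set (ℕ → X)) : ℝ :=
  max (sSup ((fun u => rhoInf u B) '' A)) (sSup ((fun v => rhoInf v A) '' B))

/-- The shadowing property for a set-valued map: every `δ`-pseudo-orbit
(`d(x_{n+1}, F(x_n)) < δ`) is `ε`-shadowed by an `F`-orbit. -/
def SVShadowing (F : X → Set X) : Prop :=
  ∀ ε > (0 : ℝ), ∃ δ > (0 : ℝ), ∀ x : ℕ → X,
    (∀ n : ℕ, infDist (x (n + 1)) (F (x n)) < δ) →
    ∃ y : ℕ → X, (∀ n : ℕ, y (n + 1) ∈ F (y n)) ∧ ∀ n : ℕ, dist (x n) (y n) < ε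

/-- The (single-valued) shadowing property for the shift `σ_rF` on `(Orb_r(X), ρ)`. -/
def ShiftShadowingR (F : X → Set X) : Prop :=
  ∀ ε > (0 : ℝ), ∃ δ > (0 : ℝ), ∀ z : ℕ → (ℕ → X),
    (∀ n : ℕ, z n ∈ OrbR F) →
    (∀ n : ℕ, rho (shiftSeq (z n)) (z (n + 1)) < δ) →
    ∃ w ∈ OrbR F, ∀ n : ℕ, rho (shiftSeq^[n] w) (z n) < ε

/-- The (single-valued) shadowing property for the shift `σ_lF` on `(Orb_l(X), ρ)`. -/
def ShiftShadowingL (F : X → Set X) : Prop :=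
  ∀ ε > (0 : ℝ), ∃ δ > (0 : ℝ), ∀ z : ℕ → (ℕ → X),
    (∀ n : ℕ, z n ∈ OrbL F) →
    (∀ n : ℕ, rho (shiftSeq (z n)) (z (n + 1)) < δ) →
    ∃ w ∈ OrbL F, ∀ n : ℕ, rho (shiftSeq^[n] w) (z n) < ε

/-- `F` is expansive with expansive constant `δ`. -/
def SVExpansiveWith (F : X → Set X) (δ : ℝ) : Prop :=
  ∀ u ∈ OrbR F, ∀ v ∈ OrbR F, (∀ n : ℕ, dist (u n) (v n) < δ) → u 0 = v 0

/-- The shift `σ_rF` is expansive (as a single-valued map on `(Orb_r(X), ρ)`)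
with expansive constant `c`. -/
def ShiftExpansiveWith (F : X → Set X) (c : ℝ) : Prop :=
  ∀ u ∈ OrbR F, ∀ v ∈ OrbR F,
    (∀ k : ℕ, rho (shiftSeq^[k] u) (shiftSeq^[k] v) ≤ c) → u = v

/-- The induced set-valued map `F_inv` on `Orb_inv(X)`: `F_inv([x_n]) = F(x_0) × [x_n]`,
i.e. all sequences `(z, x_0, x_1, …)` with `z ∈ F(x_0)`. -/
def Finv (F : X → Set X) (u : ℕ → X) : Set (ℕ → X) :=
  {v | v 0 ∈ F (u 0) ∧ ∀ n : ℕ, v (n + 1) = u n}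

/-- The shadowing property of `F_inv` as a set-valued map on `(Orb_inv(X), ρ)`. -/
def FinvShadowing (F : X → Set X) : Prop :=
  ∀ ε > (0 : ℝ), ∃ δ > (0 : ℝ), ∀ x : ℕ → (ℕ → X),
    (∀ n : ℕ, x n ∈ OrbInv F) →
    (∀ n : ℕ, rhoInf (x (n + 1)) (Finv F (x n)) < δ) →
    ∃ y : ℕ → (ℕ → X), (∀ n : ℕ, y n ∈ OrbInv F) ∧
      (∀ n : ℕ, y (n + 1) ∈ Finv F (y n)) ∧ ∀ n : ℕ, rho (x n) (y n) < ε

/-- Iterates of a set-valued map: `F^0(x) = {x}`, `F^{k+1}(x) = ⋃_{z ∈ F^k(x)} F z`. -/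
def SVIter (F : X → Set X) : ℕ → X → Set X
  | 0 => fun x => {x}
  | n + 1 => fun x => SVImage F (SVIter F n x)

open Filter Topology Uniformity

/-- Pairs of points whose `g`-orbits stay `E`-close up to time `n`. -/
def dynClose {Z : Type*} (g : Z → Z) (E : Set (Z × Z)) (n : ℕ) : Set (Z × Z) :=
  {q | ∀ k ≤ n, (g^[k] q.1, g^[k] q.2) ∈ E}

lemma dynClose_antitone {Z : Type*} (g : Z → Z) (E : Set (Z × Z)) : Antitone (dynClose g E) :=
  fun _ _ hab _ hq k hk => hq k (hk.trans hab)

lemma iterate_mem_dynClose {Z : Type*} {g : Z → Z} {E : Set (Z × Z)} {m r : ℕ} {x y : Z}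
    (h : (x, y) ∈ dynClose g E (m + r)) : (g^[r] x, g^[r] y) ∈ dynClose g E m := by
  intro k hk
  have := h (k + r) (by omega)
  simpa only [Function.iterate_add_apply] using this

lemma mem_dynClose_succ {Z : Type*} {g : Z → Z} {E : Set (Z × Z)} {n : ℕ} {x y : Z}
    (h0 : (x, y) ∈ E) (h : (g x, g y) ∈ dynClose g E n) : (x, y) ∈ dynClose g E (n + 1) := by
  intro k hk
  cases k with
  | zero => exact h0
  | succ k => exact h k (by omega)

lemma isClosed_dynClose {Z : Type*} [TopologicalSpace Z] {g : Z → Z} (hg : Continuous g)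
    {E : Set (Z × Z)} (hE : IsClosed E) (n : ℕ) : IsClosed (dynClose g E n) := by
  simp only [dynClose, ofPred_forall]
  refine isClosed_iInter fun k => isClosed_iInter fun _ => hE.preimage ?_
  exact ((hg.iterate k).comp continuous_fst).prodMk ((hg.iterate k).comp continuous_snd)

lemma UniformContinuous.dynClose_mem {Z : Type*} [UniformSpace Z] {g : Z → Z}
    (hg : UniformContinuous g) {E : Set (Z × Z)} (hE : E ∈ 𝓤 Z) (n : ℕ) :
    dynClose g E n ∈ 𝓤 Z := by
  have : dynClose g E n = ⋂ k ∈ Set.Iic n, {q : Z × Z | (g^[k] q.1, g^[k] q.2) ∈ E} := by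
    ext q; simp [dynClose]
  rw [this, biInter_mem (Set.finite_Iic n)]
  exact fun k _ => UniformContinuous.iterate g k hg hE

/-- For a positively expansive map, long dynamical closeness forces closeness. -/
lemma exists_dynClose_subset {Z : Type*} [UniformSpace Z] [CompactSpace Z]
    {g : Z → Z} (hg : Continuous g) {E : Set (Z × Z)} (hE : IsClosed E)
    (hexp : ∀ x y, (∀ n, (g^[n] x, g^[n] y) ∈ E) → x = y) {U : Set (Z × Z)} (hU : U ∈ 𝓤 Z) :
    ∃ n, dynClose g E n ⊆ U := by
  refine exists_subset_nhds_of_isCompact' (V := dynClose g E)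
    (dynClose_antitone g E).directed_ge
    (fun n => (isClosed_dynClose hg hE n).isCompact) (fun n => isClosed_dynClose hg hE n) ?_
  rintro ⟨x, y⟩ hxy
  obtain rfl : x = y := hexp x y fun n => mem_iInter.1 hxy n n le_rfl
  exact nhds_le_uniformity x hU

/-- A continuous open map on a compact space is uniformly open. -/
lemma IsOpenMap.exists_uniform_lift {Z : Type*} [UniformSpace Z] [CompactSpace Z] [T2Space Z]
    {g : Z → Z} (hg : Continuous g) (ho : IsOpenMap g) {E : Set (Z × Z)} (hE : E ∈ 𝓤 Z) :
    ∃ W ∈ 𝓤 Z, ∀ u v, (g u, v) ∈ W → ∃ v', g v' = v ∧ (u, v') ∈ E := by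
  set G : Set (Z × Z) := Prod.map id g '' interior E
  have hG : IsOpen G := (IsOpenMap.id.prodMap ho) _ isOpen_interior
  have hK : IsCompact (Prod.map g id '' Gᶜ) :=
    hG.isClosed_compl.isCompact.image (hg.prodMap continuous_id)
  refine ⟨(Prod.map g id '' Gᶜ)ᶜ, ?_, ?_⟩
  · rw [← nhdsSet_diagonal_eq_uniformity, hK.isClosed.isOpen_compl.mem_nhdsSet]
    rintro ⟨a, b⟩ hab ⟨⟨u, v⟩, huv, h⟩
    obtain rfl : a = b := hab
    simp only [Prod.map_apply, id, Prod.mk.injEq] at h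
    refine huv ⟨(u, u), ?_, by simp [h.1, h.2]⟩
    exact subset_interior_iff_mem_nhdsSet.2
      (by rw [nhdsSet_diagonal_eq_uniformity]; exact hE) (mem_diagonal u)
  · intro u v huv
    have : (u, v) ∈ G := by
      by_contra h
      exact huv ⟨(u, v), h, rfl⟩
    obtain ⟨⟨a, b⟩, hab, h⟩ := this
    simp only [Prod.map_apply, id, Prod.mk.injEq] at h
    exact ⟨b, h.2, h.1 ▸ interior_subset hab⟩

lemma exists_lift_iterate {Z : Type*} {g : Z → Z} {E W : Set (Z × Z)} {m : ℕ}
    (hW : ∀ u v, (g u, v) ∈ W → ∃ v', g v' = v ∧ (u, v') ∈ E) (hm : dynClose g E m ⊆ W)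
    (k : ℕ) (u v : Z) (h : (g^[k] u, v) ∈ dynClose g E m) :
    ∃ v', g^[k] v' = v ∧ (u, v') ∈ dynClose g E (m + k) := by
  induction k generalizing u with
  | zero => exact ⟨v, rfl, h⟩
  | succ k ih =>
    obtain ⟨v₁, rfl, h₁⟩ := ih (g u) h
    obtain ⟨v₂, rfl, h₂⟩ := hW u v₁ (hm (dynClose_antitone g E (Nat.le_add_right m k) h₁))
    exact ⟨v₂, rfl, mem_dynClose_succ h₂ h₁⟩

/-- Pseudo-orbits with small error follow true orbits for a bounded time. -/
lemma UniformContinuous.exists_pseudoOrbit_close {Z : Type*} [UniformSpace Z] {g : Z → Z}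
    (hg : UniformContinuous g) (k : ℕ) {A : Set (Z × Z)} (hA : A ∈ 𝓤 Z) :
    ∃ D ∈ 𝓤 Z, ∀ z : ℕ → Z, (∀ n, (g (z n), z (n + 1)) ∈ D) →
      ∀ i ≤ k, ∀ j, (g^[i] (z j), z (j + i)) ∈ A := by
  induction k generalizing A with
  | zero =>
    refine ⟨univ, univ_mem, fun z _ i hi j => ?_⟩
    obtain rfl : i = 0 := by omega
    exact refl_mem_uniformity hA
  | succ k ih =>
    obtain ⟨B, hB, hBA⟩ := comp_mem_uniformity_sets hA
    obtain ⟨D, hD, h⟩ := ih (inter_mem hA (hg hB))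
    refine ⟨D ∩ B, inter_mem hD hB, fun z hz i hi j => ?_⟩
    have h' := h z fun n => (hz n).1
    rcases Nat.le_succ_iff.1 hi with hi | rfl
    · exact (h' i hi j).1
    · rw [Function.iterate_succ_apply']
      exact hBA ⟨g (z (j + k)), (h' k le_rfl j).2, (hz (j + k)).2⟩

/-- A continuous open positively expansive map on a compact Hausdorff uniform space has the
shadowing property. -/
theorem IsOpenMap.shadowing_of_expansive {Z : Type*} [UniformSpace Z] [CompactSpace Z]
    [T2Space Z] {g : Z → Z} (hg : Continuous g) (ho : IsOpenMap g)
    (hexp : ∃ E ∈ 𝓤 Z, ∀ x y, (∀ n, (g^[n] x, g^[n] y) ∈ E) → x = y)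
    {U : Set (Z × Z)} (hU : U ∈ 𝓤 Z) :
    ∃ D ∈ 𝓤 Z, ∀ z : ℕ → Z, (∀ n, (g (z n), z (n + 1)) ∈ D) →
      ∃ w, ∀ n, (g^[n] w, z n) ∈ U := by
  obtain ⟨E, hE, hEc, hexp⟩ : ∃ E ∈ 𝓤 Z, IsClosed E ∧
      ∀ x y, (∀ n, (g^[n] x, g^[n] y) ∈ E) → x = y := by
    obtain ⟨E₀, hE₀, h⟩ := hexp
    obtain ⟨E, ⟨hE, hEc⟩, hEE⟩ := uniformity_hasBasis_closed.mem_iff.1 hE₀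
    exact ⟨E, hE, hEc, fun x y hxy => h x y fun n => hEE (hxy n)⟩
  have hgu : UniformContinuous g := CompactSpace.uniformContinuous_of_continuous hg
  obtain ⟨U₁, hU₁, hsymm, hUU⟩ := comp_symm_mem_uniformity_sets hU
  obtain ⟨W, hW, hlift⟩ := ho.exists_uniform_lift hg hE
  obtain ⟨m, hm⟩ := exists_dynClose_subset hg hEc hexp (inter_mem hW hU₁)
  obtain ⟨T, hT, hTT⟩ := comp_mem_uniformity_sets (hgu.dynClose_mem hE m)
  obtain ⟨p, hp⟩ := exists_dynClose_subset hg hEc hexp hT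
  obtain ⟨k, hk0, hpk⟩ : ∃ k, 0 < k ∧ p ≤ m + k := ⟨p + 1, by omega, by omega⟩
  have hkT : dynClose g E (m + k) ⊆ T := (dynClose_antitone g E hpk).trans hp
  obtain ⟨D, hD, hDz⟩ := hgu.exists_pseudoOrbit_close k
    (inter_mem (hgu.dynClose_mem hE (m + k)) hU₁)
  refine ⟨D, hD, fun z hz => ?_⟩
  have hz' := hDz z hz
  have hfin : ∀ n j, ∃ w, ∀ i ≤ n,
      (z (j + k * i), g^[k * i] w) ∈ dynClose g E (m + k) := by
    intro n
    induction n with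
    | zero =>
      intro j
      refine ⟨z j, fun i hi => ?_⟩
      obtain rfl : i = 0 := by omega
      exact refl_mem_uniformity (hgu.dynClose_mem hE _)
    | succ n ih =>
      intro j
      obtain ⟨w₁, hw₁⟩ := ih (j + k)
      obtain ⟨w, rfl, hw⟩ := exists_lift_iterate hlift (hm.trans inter_subset_left) k (z j) w₁
        (hTT ⟨z (j + k), hkT (hz' k le_rfl j).1, hkT (hw₁ 0 (Nat.zero_le n))⟩)
      refine ⟨w, fun i hi => ?_⟩
      cases i with
      | zero => exact hw
      | succ i =>
        have := hw₁ i (by omega)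
        rw [← Function.iterate_add_apply] at this
        rwa [Nat.mul_succ, add_comm (k * i) k, ← add_assoc, add_comm k (k * i)]
  obtain ⟨w, hw⟩ : (⋂ n, {w | ∀ i ≤ n,
      (z (k * i), g^[k * i] w) ∈ dynClose g E (m + k)}).Nonempty := by
    have hcl : ∀ n, IsClosed {w | ∀ i ≤ n,
        (z (k * i), g^[k * i] w) ∈ dynClose g E (m + k)} := fun n => by
      simp only [ofPred_forall]
      exact isClosed_iInter fun i => isClosed_iInter fun _ =>
        (isClosed_dynClose hg hEc _).preimage (continuous_const.prodMk (hg.iterate _))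
    refine IsCompact.nonempty_iInter_of_sequence_nonempty_isCompact_isClosed _
      (fun n w hw i hi => hw i (by omega)) (fun n => ?_) (hcl 0).isCompact hcl
    simpa [Set.Nonempty] using hfin n 0
  refine ⟨w, fun n => ?_⟩
  have hr : n % k < k := Nat.mod_lt _ hk0
  have hn : k * (n / k) + n % k = n := Nat.div_add_mod n k
  have h₁ : (g^[n % k] (z (k * (n / k))), g^[n] w) ∈ U₁ := by
    have := mem_iInter.1 hw (n / k) (n / k) le_rfl
    have := iterate_mem_dynClose (dynClose_antitone g E (show m + n % k ≤ m + k by omega) this)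
    rw [← Function.iterate_add_apply, add_comm (n % k), hn] at this
    exact (hm this).2
  have h₂ : (g^[n % k] (z (k * (n / k))), z n) ∈ U₁ := by
    have := (hz' (n % k) hr.le (k * (n / k))).2
    rwa [hn] at this
  exact hUU ⟨_, hsymm.symm _ _ h₁, h₂⟩

lemma SVUpperSC.isClosed_graph {F : X → Set X} (hF : SVUpperSC F)
    (hFc : SVCompactValued F) : IsClosed {q : X × X | q.2 ∈ F q.1} := by
  rw [← isOpen_compl_iff, isOpen_iff_mem_nhds]
  rintro ⟨x, y⟩ hxy
  obtain ⟨A, B, hA, hB, hxA, hyB, hAB⟩ :=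
    SeparatedNhds.of_isCompact_isCompact (hFc x).2 (isCompact_singleton (x := y))
      (disjoint_singleton_right.2 hxy)
  obtain ⟨V, hV, hxV, hVA⟩ := hF x A hA hxA
  filter_upwards [prod_mem_nhds (hV.mem_nhds hxV) (hB.mem_nhds (hyB rfl))]
  rintro ⟨a, b⟩ ⟨ha, hb⟩ h
  exact disjoint_left.1 hAB (hVA a ha h) hb

lemma isClosed_orbR {F : X → Set X} (hF : SVUpperSC F)
    (hFc : SVCompactValued F) : IsClosed (OrbR F) := by
  simp only [OrbR, ofPred_forall]
  exact isClosed_iInter fun n => IsClosed.preimage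
    (f := fun u : ℕ → X => (u n, u (n + 1)))
    ((continuous_apply n).prodMk (continuous_apply (n + 1))) (hF.isClosed_graph hFc)

lemma continuous_sigmaR (F : X → Set X) : Continuous (sigmaR F) :=
  continuous_induced_rng.2
    (continuous_pi fun n => (continuous_apply (n + 1)).comp continuous_subtype_val)

/-- The shift on the orbit space of an open set-valued map is open. -/
lemma SVOpen.isOpenMap_sigmaR {F : X → Set X} (hopen : SVOpen F) : IsOpenMap (sigmaR F) := by
  intro A hA
  obtain ⟨A', hA', rfl⟩ := isOpen_induced_iff.1 hA
  rw [isOpen_iff_mem_nhds]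
  rintro _ ⟨u, hu, rfl⟩
  let cons : X × (ℕ → X) → ℕ → X := fun q n => Nat.casesOn n q.1 q.2
  have hcons : Continuous cons := continuous_pi fun n => by
    cases n with
    | zero => exact continuous_fst
    | succ n => exact (continuous_apply n).comp continuous_snd
  have hcu : cons (u.1 0, shiftSeq u.1) = u.1 := by
    funext n
    cases n <;> rfl
  have hmem : (u.1 0, shiftSeq u.1) ∈ cons ⁻¹' A' := by
    rw [mem_preimage, hcu]; exact hu
  obtain ⟨O, P, hO, hP, huO, huP, hOP⟩ := isOpen_prod_iff.1 (hA'.preimage hcons) _ _ hmem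
  have h₁ : ∀ᶠ v : OrbR F in 𝓝 (sigmaR F u), v.1 ∈ P :=
    continuous_subtype_val.continuousAt.eventually (hP.mem_nhds huP)
  have h₂ : ∀ᶠ v : OrbR F in 𝓝 (sigmaR F u), v.1 0 ∈ SVImage F O :=
    ((continuous_apply 0).comp continuous_subtype_val).continuousAt.eventually
      ((hopen O hO).mem_nhds (mem_biUnion huO (u.2 0)))
  filter_upwards [h₁, h₂] with v hv₁ hv₂
  obtain ⟨x, hx, hvx⟩ := mem_iUnion₂.1 hv₂
  refine ⟨⟨cons (x, v.1), fun n => ?_⟩, hOP (mk_mem_prod hx hv₁), rfl⟩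
  cases n with
  | zero => exact hvx
  | succ n => exact v.2 n

lemma coe_sigmaR_iterate {Y : Type*} (F : Y → Set Y) (n : ℕ) (u : OrbR F) :
    ((sigmaR F)^[n] u).1 = shiftSeq^[n] u.1 :=
  (show Function.Semiconj Subtype.val (sigmaR F) shiftSeq from fun _ => rfl).iterate_right n u

lemma shiftSeq_iterate_apply {Y : Type*} (u : ℕ → Y) (n k : ℕ) : shiftSeq^[n] u k = u (k + n) := by
  induction n generalizing u with
  | zero => rfl
  | succ n ih => rw [Function.iterate_succ_apply, ih]; rfl

lemma rho_term_le [CompactSpace X] (u v : ℕ → X) (n : ℕ) :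
    dist (u n) (v n) / 2 ^ (n + 1) ≤ diam (univ : Set X) / 2 / 2 ^ n := by
  rw [pow_succ', ← div_div]
  gcongr
  exact dist_le_diam_of_mem isCompact_univ.isBounded (mem_univ _) (mem_univ _)

lemma continuous_rho [CompactSpace X] :
    Continuous fun q : (ℕ → X) × (ℕ → X) => rho q.1 q.2 := by
  refine continuous_tsum (u := fun n => diam (univ : Set X) / 2 / 2 ^ n) (fun n => ?_)
    (summable_geometric_two' _) fun n q => ?_
  · fun_prop
  · rw [Real.norm_of_nonneg (by positivity)]
    exact rho_term_le _ _ n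

lemma rho_self (u : ℕ → X) : rho u u = 0 := by simp [rho]

lemma rho_pos_of_ne [CompactSpace X] {u v : ℕ → X} (h : u ≠ v) : 0 < rho u v := by
  obtain ⟨n, hn⟩ := Function.ne_iff.1 h
  have hs : Summable fun n => dist (u n) (v n) / 2 ^ (n + 1) :=
    (summable_geometric_two' _).of_nonneg_of_le (fun n => by positivity) (rho_term_le u v)
  exact hs.tsum_pos (fun n => by positivity) n (div_pos (dist_pos.2 hn) (by positivity))

lemma setOf_rho_lt_mem_uniformity [CompactSpace X] {ε : ℝ} (hε : 0 < ε) :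
    {q : (ℕ → X) × (ℕ → X) | rho q.1 q.2 < ε} ∈ 𝓤 (ℕ → X) := by
  rw [← nhdsSet_diagonal_eq_uniformity,
    (isOpen_lt continuous_rho continuous_const).mem_nhdsSet]
  rintro ⟨u, v⟩ huv
  obtain rfl : u = v := huv
  simpa [rho_self] using hε

lemma exists_setOf_rho_lt_subset [CompactSpace X] {D : Set ((ℕ → X) × (ℕ → X))}
    (hD : D ∈ 𝓤 (ℕ → X)) : ∃ δ > 0, ∀ u v : ℕ → X, rho u v < δ → (u, v) ∈ D := by
  rw [← nhdsSet_diagonal_eq_uniformity] at hD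
  obtain ⟨δ, hδ, h⟩ := (isOpen_interior (s := D)).isClosed_compl.isCompact.exists_forall_le'
    continuous_rho.continuousOn (a := 0) fun q hq => rho_pos_of_ne fun hne =>
      hq (subset_interior_iff_mem_nhdsSet.2 hD hne)
  refine ⟨δ, hδ, fun u v huv => interior_subset ?_⟩
  by_contra hc
  exact (h (u, v) hc).not_gt huv

/-- If `F` is an expansive, upper semicontinuous set-valued map with
nonempty compact values on a compact metric space and `F` is open, then the shift `σ_rF` on
`(Orb_r(X), ρ)` has the (single-valued) shadowing property. -/
theorem shift_shadowing_of_expansive_open [CompactSpace X]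
    (F : X → Set X) (hF : SVUpperSC F) (hFc : SVCompactValued F)
    (hexp : ∃ δ > (0 : ℝ), SVExpansiveWith F δ) (hopen : SVOpen F) :
    ShiftShadowingR F := by
  have hcomp : CompactSpace (OrbR F) :=
    isCompact_iff_compactSpace.1 (isClosed_orbR hF hFc).isCompact
  have hexp' : ∃ E ∈ 𝓤 (OrbR F), ∀ x y : OrbR F,
      (∀ n, ((sigmaR F)^[n] x, (sigmaR F)^[n] y) ∈ E) → x = y := by
    obtain ⟨δ, hδ, h⟩ := hexp
    have huc : UniformContinuous fun u : OrbR F => u.1 0 :=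
      (Pi.uniformContinuous_proj (fun _ : ℕ => X) 0).comp uniformContinuous_subtype_val
    refine ⟨_, huc (dist_mem_uniformity hδ), fun x y hxy => ?_⟩
    have hd : ∀ n, dist (x.1 n) (y.1 n) < δ := fun n => by
      have := hxy n
      simpa [coe_sigmaR_iterate, shiftSeq_iterate_apply] using this
    refine Subtype.ext (funext fun k => ?_)
    have := h _ ((sigmaR F)^[k] x).2 _ ((sigmaR F)^[k] y).2 fun n => by
      simpa only [coe_sigmaR_iterate, shiftSeq_iterate_apply] using hd (n + k)
    simpa [coe_sigmaR_iterate, shiftSeq_iterate_apply] using this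
  intro ε hε
  obtain ⟨D, hD, hshadow⟩ := hopen.isOpenMap_sigmaR.shadowing_of_expansive (continuous_sigmaR F)
    hexp' (uniformContinuous_subtype_val (setOf_rho_lt_mem_uniformity hε))
  rw [uniformity_subtype, mem_comap] at hD
  obtain ⟨D', hD', hDD⟩ := hD
  obtain ⟨δ, hδ, h⟩ := exists_setOf_rho_lt_subset hD'
  refine ⟨δ, hδ, fun z hz hpseudo => ?_⟩
  obtain ⟨w, hw⟩ := hshadow (fun n => ⟨z n, hz n⟩) fun n => hDD (h _ _ (hpseudo n))
  refine ⟨w.1, w.2, fun n => ?_⟩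
  rw [← coe_sigmaR_iterate]
  exact hw n
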